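/- Let m ∈ ℕ, n : Fin m → ℕ, and let B_S be the associated 3-cost game board. For every strategy s on B_S such that P*_s is closed, define f : Fin m → Bool by f(i) = true if and only if pⁱ↑ ∈ final(P*_s). Then ∑_{p ∈ final(P*_s)} C(p) = ( ∑_{i : f(i) = true} n(i), ∑_{i : f(i) = false} n(i), m ) as a vector in ℝ³. -/

import Mathlib

open Classical

/-- A `k`-cost game board: positions `P` (finite) partitioned into controller
positions `Pc` (`P∘`) and spoiler positions `Psq` (`P□`), an initial position `p0`,
a set `F` of final positions with no outgoing edges, a cost function `C : P → ℝ^k`,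
and an acyclic edge relation `M`. -/
structure CostGameBoard (k : ℕ) (P : Type) [Fintype P] where
  Pc : Set P
  Psq : Set P
  p0 : P
  F : Set P
  C : P → Fin k → ℝ
  M : P → P → Prop
  cover : Pc ∪ Psq = Set.univ
  disj : Pc ∩ Psq = ∅
  acyclic : ∀ p : P, ¬ Relation.TransGen M p p
  final_no_out : ∀ p ∈ F, ∀ p' : P, ¬ M p p'

variable {k : ℕ} {P : Type} [Fintype P]

/-- `s` is a strategy: whenever the last position of a nonempty sequence has an
outgoing `M`-edge, the strategy picks an `M`-successor of it. -/
def IsStrategy (B : CostGameBoard k P) (s : List P → P) : Prop :=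
  ∀ (ρ : List P) (p : P), ρ.getLast? = some p → (∃ p', B.M p p') → B.M p (s ρ)

/-- `ρ` is a successful play generated by `s`: it is nonempty, starts at `p0`,
follows `M`-edges, ends in `F`, and follows `s` at controller positions. -/
def IsPlay (B : CostGameBoard k P) (s : List P → P) (ρ : List P) : Prop :=
  ρ ≠ [] ∧
  ρ.head? = some B.p0 ∧
  (∀ (i : ℕ) (p p' : P), ρ[i]? = some p → ρ[i + 1]? = some p' → B.M p p') ∧
  (∃ p ∈ B.F, ρ.getLast? = some p) ∧
  (∀ (i : ℕ) (p p' : P), ρ[i]? = some p → ρ[i + 1]? = some p' →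
      p ∈ B.Pc → p' = s (ρ.take (i + 1)))

/-- `P*_s`: the set of successful plays generated by `s`. -/
def Plays (B : CostGameBoard k P) (s : List P → P) : Set (List P) :=
  {ρ | IsPlay B s ρ}

/-- `P*_s` is closed: at every spoiler position occurring (not last) in a play,
every alternative spoiler move can be extended to a play with the same prefix. -/
def ClosedPlays (B : CostGameBoard k P) (s : List P → P) : Prop :=
  ∀ ρ ∈ Plays B s, ∀ (i : ℕ) (p p' : P), ρ[i]? = some p → i + 1 < ρ.length →
    p ∈ B.Psq → B.M p p' →
      ∃ ρ' ∈ Plays B s, ρ'.take (i + 1) = ρ.take (i + 1) ∧ ρ'[i + 1]? = some p'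

/-- `final(P*_s)`: the set of last positions of successful plays generated by `s`. -/
def finals (B : CostGameBoard k P) (s : List P → P) : Set P :=
  {p | ∃ ρ ∈ Plays B s, ρ.getLast? = some p}

/-- The `j`-th component of `∑_{p ∈ final(P*_s)} C(p)`. -/
noncomputable def finalCost (B : CostGameBoard k P) (s : List P → P) (j : Fin k) : ℝ :=
  ∑ p ∈ (Set.toFinite (finals B s)).toFinset, B.C p j

/-- Positions of the board `B_S` associated with a Distinct Partition instance:
the initial position `p₀`, and for each index `i` the positions `pⁱ`, `pⁱ↑`, `pⁱ↓`. -/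
inductive PartPos (m : ℕ) : Type
  | start : PartPos m
  | mid : Fin m → PartPos m
  | up : Fin m → PartPos m
  | down : Fin m → PartPos m
  deriving DecidableEq, Fintype

/-- Edges of the board `B_S`. -/
inductive partM (m : ℕ) : PartPos m → PartPos m → Prop
  | toMid (i : Fin m) : partM m .start (.mid i)
  | toUp (i : Fin m) : partM m (.mid i) (.up i)
  | toDown (i : Fin m) : partM m (.mid i) (.down i)

/-- Costs of the board `B_S`: `C(pⁱ↑) = (n i, 0, 1)`, `C(pⁱ↓) = (0, n i, 1)`,
and `(0,0,0)` elsewhere. -/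
def partC {m : ℕ} (n : Fin m → ℕ) : PartPos m → Fin 3 → ℝ
  | .up i => ![(n i : ℝ), 0, 1]
  | .down i => ![0, (n i : ℝ), 1]
  | _ => ![0, 0, 0]

/-- Rank function witnessing acyclicity of `partM`. -/
def partRank {m : ℕ} : PartPos m → ℕ
  | .start => 0
  | .mid _ => 1
  | .up _ => 2
  | .down _ => 2

lemma partM_rank {m : ℕ} {p q : PartPos m} (h : partM m p q) : partRank p < partRank q := by
  cases h <;> simp [partRank]

/-- The 3-cost game board `B_S` associated with a Distinct Partition instance. -/
def partBoard (m : ℕ) (n : Fin m → ℕ) : CostGameBoard 3 (PartPos m) where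
  Pc := {p | p ≠ .start}
  Psq := {.start}
  p0 := .start
  F := {p | ∃ i : Fin m, p = .up i ∨ p = .down i}
  C := partC n
  M := partM m
  cover := by
    ext p
    by_cases h : p = PartPos.start <;> simp [h]
  disj := by
    ext p
    simp only [Set.mem_inter_iff, Set.mem_setOf_eq, Set.mem_singleton_iff, Set.mem_empty_iff_false,
      iff_false, not_and]
    tauto
  acyclic := by
    intro p hp
    have key : ∀ a b : PartPos m, Relation.TransGen (partM m) a b → partRank a < partRank b := by
      intro a b h
      induction h with
      | single h => exact partM_rank h
      | tail _ h ih => exact ih.trans (partM_rank h)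
    exact lt_irrefl _ (key p p hp)
  final_no_out := by
    rintro p ⟨i, hi | hi⟩ p' hM <;> subst hi <;> cases hM

/-- The final position reached when the spoiler picks index `i` and the controller follows `s`. -/
def partReply {m : ℕ} (s : List (PartPos m) → PartPos m) (i : Fin m) : PartPos m :=
  s [.start, .mid i]

lemma partReply_eq_up_or_down {m : ℕ} {n : Fin m → ℕ} {s : List (PartPos m) → PartPos m}
    (hs : IsStrategy (partBoard m n) s) (i : Fin m) :
    partReply s i = .up i ∨ partReply s i = .down i := by
  have h : partM m (.mid i) (partReply s i) := hs [.start, .mid i] (.mid i) rfl ⟨_, .toUp i⟩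
  generalize partReply s i = q at h
  cases h <;> simp

lemma partReply_injective {m : ℕ} {n : Fin m → ℕ} {s : List (PartPos m) → PartPos m}
    (hs : IsStrategy (partBoard m n) s) : Function.Injective (partReply s) := by
  intro i j hij
  rcases partReply_eq_up_or_down hs i with hi | hi <;>
    rcases partReply_eq_up_or_down hs j with hj | hj <;>
    simpa [hi, hj] using hij

lemma isPlay_partBoard_of_reply {m : ℕ} {n : Fin m → ℕ} {s : List (PartPos m) → PartPos m}
    (hs : IsStrategy (partBoard m n) s) (i : Fin m) :
    IsPlay (partBoard m n) s [.start, .mid i, partReply s i] := by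
  refine ⟨by simp, rfl, ?_, ⟨partReply s i, ⟨i, partReply_eq_up_or_down hs i⟩, rfl⟩, ?_⟩
  · rintro (_ | _ | l) p p' hp hp'
    · obtain rfl : PartPos.start = p := by simpa using hp
      obtain rfl : PartPos.mid i = p' := by simpa using hp'
      exact .toMid i
    · obtain rfl : PartPos.mid i = p := by simpa using hp
      obtain rfl : partReply s i = p' := by simpa using hp'
      exact hs [.start, .mid i] (.mid i) rfl ⟨_, .toUp i⟩
    · simp at hp'
  · rintro (_ | _ | l) p p' hp hp' hc
    · obtain rfl : PartPos.start = p := by simpa using hp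
      exact absurd rfl hc
    · obtain rfl : partReply s i = p' := by simpa using hp'
      rfl
    · simp at hp'

lemma eq_of_isPlay_partBoard {m : ℕ} {n : Fin m → ℕ} {s : List (PartPos m) → PartPos m}
    {ρ : List (PartPos m)} (h : IsPlay (partBoard m n) s ρ) :
    ∃ i, ρ = [.start, .mid i, partReply s i] := by
  obtain ⟨-, hhead, hM, ⟨p, ⟨i, hp⟩, hlast⟩, hc⟩ := h
  have edge : ∀ (l : ℕ) (p p' : PartPos m), ρ[l]? = some p → ρ[l + 1]? = some p' →
      partM m p p' := hM
  match ρ with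
  | [] => simp at hhead
  | [a] =>
    obtain rfl : a = .start := by simpa [partBoard] using hhead
    obtain rfl : PartPos.start = p := by simpa using hlast
    simp at hp
  | [a, b] =>
    obtain rfl : a = .start := by simpa [partBoard] using hhead
    obtain rfl : b = p := by simpa using hlast
    have e := edge 0 .start b rfl rfl
    cases e
    simp at hp
  | [a, b, c] =>
    obtain rfl : a = .start := by simpa [partBoard] using hhead
    have e := edge 0 .start b rfl rfl
    cases e with
    | toMid j => exact ⟨j, by rw [hc 1 (.mid j) c rfl rfl nofun]; rfl⟩
  | a :: b :: c :: d :: l =>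
    have h₁ := partM_rank (edge 0 a b rfl rfl)
    have h₂ := partM_rank (edge 1 b c rfl rfl)
    have h₃ := partM_rank (edge 2 c d rfl rfl)
    have hd : partRank d ≤ 2 := by cases d <;> simp [partRank]
    omega

lemma finals_partBoard {m : ℕ} {n : Fin m → ℕ} {s : List (PartPos m) → PartPos m}
    (hs : IsStrategy (partBoard m n) s) :
    finals (partBoard m n) s = Set.range (partReply s) := by
  ext p
  constructor
  · rintro ⟨ρ, hρ, hp⟩
    obtain ⟨i, rfl⟩ := eq_of_isPlay_partBoard hρ
    exact ⟨i, by simpa using hp⟩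
  · rintro ⟨i, rfl⟩
    exact ⟨_, isPlay_partBoard_of_reply hs i, rfl⟩

lemma finalCost_partBoard {m : ℕ} {n : Fin m → ℕ} {s : List (PartPos m) → PartPos m}
    (hs : IsStrategy (partBoard m n) s) (j : Fin 3) :
    finalCost (partBoard m n) s j = ∑ i, partC n (partReply s i) j := by
  have h : (Set.toFinite (finals (partBoard m n) s)).toFinset =
      Finset.univ.image (partReply s) := by
    ext p
    simp [finals_partBoard hs]
  rw [finalCost, h, Finset.sum_image (partReply_injective hs).injOn]
  rfl

lemma up_mem_finals_partBoard_iff {m : ℕ} {n : Fin m → ℕ} {s : List (PartPos m) → PartPos m}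
    (hs : IsStrategy (partBoard m n) s) (i : Fin m) :
    PartPos.up i ∈ finals (partBoard m n) s ↔ partReply s i = .up i := by
  rw [finals_partBoard hs]
  refine ⟨?_, fun h => ⟨i, h⟩⟩
  rintro ⟨l, hl⟩
  rcases partReply_eq_up_or_down hs l with h | h
  · obtain rfl : l = i := by simpa [h] using hl
    exact h
  · simp [h] at hl

/-- For every strategy on `B_S` whose set of plays is closed, with
`f i = true ↔ pⁱ↑ ∈ final(P*_s)`, the total cost of the final positions is the
vector `(∑_{i : f i = true} n i, ∑_{i : f i = false} n i, m) ∈ ℝ³`. -/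
theorem partBoard_finalCost_eq (m : ℕ) (n : Fin m → ℕ)
    (s : List (PartPos m) → PartPos m)
    (hstrat : IsStrategy (partBoard m n) s)
    (hclosed : ClosedPlays (partBoard m n) s)
    (f : Fin m → Bool)
    (hf : ∀ i : Fin m, f i = true ↔ PartPos.up i ∈ finals (partBoard m n) s) :
    ∀ j : Fin 3, finalCost (partBoard m n) s j =
      ![(∑ i ∈ Finset.univ.filter (fun i => f i = true), (n i : ℝ)),
        (∑ i ∈ Finset.univ.filter (fun i => f i = false), (n i : ℝ)),
        (m : ℝ)] j := by
  have hC : ∀ i, partC n (partReply s i) =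
      if f i = true then ![(n i : ℝ), 0, 1] else ![0, (n i : ℝ), 1] := by
    intro i
    have hfi := (hf i).trans (up_mem_finals_partBoard_iff hstrat i)
    rcases partReply_eq_up_or_down hstrat i with h | h
    · rw [if_pos (hfi.2 h), h]
      rfl
    · rw [if_neg (fun h' => by simpa [h] using hfi.1 h'), h]
      rfl
  intro j
  rw [finalCost_partBoard hstrat]
  simp only [hC]
  fin_cases j
  · simp [Finset.sum_filter, ite_apply]
  · simp only [Finset.sum_filter]
    refine Finset.sum_congr rfl fun i _ => ?_
    cases f i <;> simp
  · simp [ite_apply]
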